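/- Consider a sequence of finite populations indexed by n = m·k (m → ∞, k and 0 < ℓ < k fixed) in the design-based stratified setup, with treatment assigned according to Assumption 1. Suppose (i) (1/n)·max_{d∈{0,1}} max_{1≤i≤n} Y_i(d)² → 0 as n → ∞; (ii) 0 < liminf_n n·Var[Δ̂_n] ≤ limsup_n n·Var[Δ̂_n] < ∞; and (iii) Ṽ_n is a sequence of nonnegative random variables (estimators of Var[Δ̂_n]) such that n·|Ṽ_n − E[Ṽ_n]| → 0 in probability. Then liminf_{n→∞} P{ Δ̂_n − √Ṽ_n · z_{1−α/2} ≤ Δ_n ≤ Δ̂_n + √Ṽ_n · z_{1−α/2} } ≥ 1 − α, where z_{1−α/2} is the 1−α/2 quantile of the standard normal distribution, if and only if liminf_{n→∞} n·( E[Ṽ_n] − Var[Δ̂_n] ) ≥ 0. -/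

import Mathlib

open MeasureTheory ProbabilityTheory Filter Finset Topology

noncomputable section

namespace DesignBased

/-- The uniform (probability) measure on a finite set of outcomes. -/
def uniformFinset {α : Type*} [MeasurableSpace α] (S : Finset α) : Measure α :=
  ((S.card : ENNReal))⁻¹ • ∑ d ∈ S, Measure.dirac d

/-- Assignment vectors for a stratum of size `k` with exactly `ℓ` treated units. -/
def assignSet (k ℓ : ℕ) : Finset (Fin k → Bool) :=
  Finset.univ.filter fun d => (Finset.univ.filter fun i => d i = true).card = ℓ

/-- Assumption 1: the treatment assignment `D` is distributed as the product, over the `m`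
strata, of the uniform distribution on assignment vectors with exactly `ℓ` treated units. -/
def Assumption1 {Ω : Type*} [MeasurableSpace Ω] (P : Measure Ω) (m k ℓ : ℕ)
    (D : Ω → Fin m → Fin k → Bool) : Prop :=
  Measurable D ∧
    Measure.map D P = Measure.pi fun _ : Fin m => uniformFinset (assignSet k ℓ)

variable {Ω : Type*}

/-- The difference-in-means estimator. -/
def hatDelta (m k ℓ : ℕ) (Y1 Y0 : Fin m → Fin k → ℝ)
    (D : Ω → Fin m → Fin k → Bool) (ω : Ω) : ℝ :=
  ((m : ℝ) * ℓ)⁻¹ * ∑ j, ∑ i, (if D ω j i then Y1 j i else 0)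
    - ((m : ℝ) * ((k : ℝ) - ℓ))⁻¹ * ∑ j, ∑ i, (if D ω j i then 0 else Y0 j i)

/-- The finite population average treatment effect. -/
def Delta (m k : ℕ) (Y1 Y0 : Fin m → Fin k → ℝ) : ℝ :=
  ((m : ℝ) * k)⁻¹ * ∑ j, ∑ i, (Y1 j i - Y0 j i)

/-- The stratum-level difference-in-means estimator. -/
def hatDeltaJ (m k ℓ : ℕ) (Y1 Y0 : Fin m → Fin k → ℝ)
    (D : Ω → Fin m → Fin k → Bool) (j : Fin m) (ω : Ω) : ℝ :=
  (ℓ : ℝ)⁻¹ * ∑ i, (if D ω j i then Y1 j i else 0)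
    - ((k : ℝ) - ℓ)⁻¹ * ∑ i, (if D ω j i then 0 else Y0 j i)

/-- The stratum-level average treatment effect. -/
def DeltaJ (m k : ℕ) (Y1 Y0 : Fin m → Fin k → ℝ) (j : Fin m) : ℝ :=
  (k : ℝ)⁻¹ * ∑ i, (Y1 j i - Y0 j i)

/-- The first stratum of the `j`-th pair of strata (strata are paired adjacently). -/
def pairA (m : ℕ) (j : Fin (m / 2)) : Fin m := ⟨2 * j.1, by have := j.2; omega⟩

/-- The second stratum of the `j`-th pair of strata. -/
def pairB (m : ℕ) (j : Fin (m / 2)) : Fin m := ⟨2 * j.1 + 1, by have := j.2; omega⟩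

/-- τ̂²ₙ. -/
def tauSq (m k ℓ : ℕ) (Y1 Y0 : Fin m → Fin k → ℝ)
    (D : Ω → Fin m → Fin k → Bool) (ω : Ω) : ℝ :=
  (m : ℝ)⁻¹ * ∑ j, (hatDeltaJ m k ℓ Y1 Y0 D j ω) ^ 2

/-- κ̂ₙ. -/
def kappaHat (m k ℓ : ℕ) (Y1 Y0 : Fin m → Fin k → ℝ)
    (D : Ω → Fin m → Fin k → Bool) (ω : Ω) : ℝ :=
  2 / (m : ℝ) * ∑ j : Fin (m / 2),
    hatDeltaJ m k ℓ Y1 Y0 D (pairA m j) ω * hatDeltaJ m k ℓ Y1 Y0 D (pairB m j) ω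

/-- The paired-strata variance estimator V̂ₙ. -/
def hatV (m k ℓ : ℕ) (Y1 Y0 : Fin m → Fin k → ℝ)
    (D : Ω → Fin m → Fin k → Bool) (ω : Ω) : ℝ :=
  (m : ℝ)⁻¹ * (tauSq m k ℓ Y1 Y0 D ω - kappaHat m k ℓ Y1 Y0 D ω)

/-- The Imai variance estimator V̂ᴵᴹₙ. -/
def hatVIM (m k ℓ : ℕ) (Y1 Y0 : Fin m → Fin k → ℝ)
    (D : Ω → Fin m → Fin k → Bool) (ω : Ω) : ℝ :=
  ((m : ℝ) * ((m : ℝ) - 1))⁻¹ *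
    ∑ j, (hatDeltaJ m k ℓ Y1 Y0 D j ω - hatDelta m k ℓ Y1 Y0 D ω) ^ 2

/-- The standard normal cumulative distribution function. -/
def stdNormCDF (x : ℝ) : ℝ := ((gaussianReal 0 1) (Set.Iic x)).toReal

/-- Conditional variance of `Z` given the sub-σ-algebra `m0`. -/
def condVar' {Ω' : Type*} (m0 : MeasurableSpace Ω') {mΩ : MeasurableSpace Ω'} (P : Measure Ω')
    (Z : Ω' → ℝ) : Ω' → ℝ :=
  P[fun ω => (Z ω - (P[Z|m0]) ω) ^ 2 | m0]


lemma prod_sub_prod {ι : Type*} (s : Finset ι) (a b : ι → ℂ) (ha : ∀ i, ‖a i‖ ≤ 1)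
    (hb : ∀ i, ‖b i‖ ≤ 1) : ‖∏ i ∈ s, a i - ∏ i ∈ s, b i‖ ≤ ∑ i ∈ s, ‖a i - b i‖ := by
  classical
  induction s using Finset.induction_on with
  | empty => simp
  | insert i s hi ih =>
    rw [Finset.prod_insert hi, Finset.prod_insert hi, Finset.sum_insert hi]
    have h1 : ‖∏ i ∈ s, a i‖ ≤ 1 := by
      rw [norm_prod]; exact Finset.prod_le_one (fun _ _ => norm_nonneg _) (fun i _ => ha i)
    calc _ = ‖(a i - b i) * ∏ i ∈ s, a i + b i * (∏ i ∈ s, a i - ∏ i ∈ s, b i)‖ := by ring_nf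
      _ ≤ ‖a i - b i‖ * ‖∏ i ∈ s, a i‖ + ‖b i‖ * ‖∏ i ∈ s, a i - ∏ i ∈ s, b i‖ := by
        refine (norm_add_le _ _).trans ?_
        rw [norm_mul, norm_mul]
      _ ≤ _ := by
        gcongr
        · exact mul_le_of_le_one_right (norm_nonneg _) h1
        · exact (mul_le_of_le_one_left (norm_nonneg _) (hb i)).trans ih

lemma exp_taylor3 (y : ℝ) (hy : |y| ≤ 1) :
    ‖Complex.exp (y * Complex.I) - (1 + y * Complex.I - (y:ℂ)^2/2)‖ ≤ |y|^3 := by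
  have hn : ‖(y * Complex.I : ℂ)‖ = |y| := by simp
  have h := Complex.exp_bound (x := y * Complex.I) (by rw [hn]; exact hy) (n := 3) (by norm_num)
  rw [hn] at h
  have e : ∑ m ∈ Finset.range 3, (y * Complex.I : ℂ) ^ m / (m.factorial : ℂ)
      = 1 + y * Complex.I - (y:ℂ)^2/2 := by
    simp [Finset.sum_range_succ, mul_pow, Nat.factorial]
    ring
  rw [e] at h
  refine h.trans ?_
  have : (0:ℝ) ≤ |y|^3 := by positivity
  norm_num [Nat.factorial]
  nlinarith

lemma charFun_one {Ω : Type*} [MeasurableSpace Ω] (P : Measure Ω) [IsProbabilityMeasure P]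
    (X : Ω → ℝ) (hX : Measurable X) (δ t : ℝ) (hδ : ∀ ω, |X ω| ≤ δ) (ht : |t| * δ ≤ 1)
    (h0 : ∫ ω, X ω ∂P = 0) :
    ‖charFun (P.map X) t - Complex.exp (-(t^2 * (∫ ω, X ω ^ 2 ∂P) / 2 : ℝ))‖ ≤
      (|t|^3 * δ + t^4 * δ^2) * ∫ ω, X ω ^ 2 ∂P := by
  set s := ∫ ω, X ω ^ 2 ∂P with hs
  obtain ⟨ω0⟩ : Nonempty Ω := P.nonempty_of_neZero
  have hδ0 : 0 ≤ δ := (abs_nonneg _).trans (hδ ω0)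
  have hXi : Integrable X P := Integrable.of_bound hX.aestronglyMeasurable δ (ae_of_all _ hδ)
  have hX2 : Integrable (fun ω => X ω ^ 2) P :=
    Integrable.of_bound (hX.pow_const 2).aestronglyMeasurable (δ^2) (ae_of_all _ fun ω => by
      rw [norm_pow]; exact pow_le_pow_left₀ (norm_nonneg _) (hδ ω) 2)
  have hs0 : 0 ≤ s := integral_nonneg fun ω => sq_nonneg _
  have hsδ : s ≤ δ^2 := by
    calc s ≤ ∫ ω, δ^2 ∂P := integral_mono hX2 (integrable_const _) (fun ω => by
            rw [← sq_abs]; exact pow_le_pow_left₀ (abs_nonneg _) (hδ ω) 2)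
      _ = δ^2 := by simp
  have hcf : charFun (P.map X) t = ∫ ω, Complex.exp ((t * X ω : ℝ) * Complex.I) ∂P := by
    rw [charFun_apply_real, integral_map hX.aemeasurable (by fun_prop)]
    simp
  have hexpi : Integrable (fun ω => Complex.exp ((t * X ω : ℝ) * Complex.I)) P :=
    Integrable.of_bound (by fun_prop) 1 (ae_of_all _ fun ω => by
      rw [Complex.norm_exp_ofReal_mul_I])
  have hpoly : Integrable (fun ω => (1 + ((t * X ω : ℝ):ℂ) * Complex.I - ((t * X ω : ℝ):ℂ)^2/2)) P := by
    have a1 : Integrable (fun ω => ((t * X ω : ℝ):ℂ)) P := (hXi.const_mul t).ofReal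
    have a2 : Integrable (fun ω => (((t * X ω)^2 : ℝ):ℂ)) P := by
      have := (hX2.const_mul (t^2)).ofReal (𝕜 := ℂ)
      simpa [mul_pow] using this
    have := ((integrable_const (1:ℂ)).add (a1.mul_const Complex.I)).sub (a2.div_const 2)
    refine this.congr (ae_of_all _ fun ω => ?_)
    simp
  have hpint : ∫ ω, (1 + ((t * X ω : ℝ):ℂ) * Complex.I - ((t * X ω : ℝ):ℂ)^2/2) ∂P
      = ((1 - t^2 * s / 2 : ℝ) : ℂ) := by
    have a1 : Integrable (fun ω => ((t * X ω : ℝ):ℂ)) P := (hXi.const_mul t).ofReal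
    have a2 : Integrable (fun ω => (((t^2 * X ω^2) : ℝ):ℂ)) P := 
      (hX2.const_mul (t^2)).ofReal (𝕜 := ℂ)
    have e : ∀ ω, (1 + ((t * X ω : ℝ):ℂ) * Complex.I - ((t * X ω : ℝ):ℂ)^2/2)
      = (1 + ((t * X ω : ℝ):ℂ) * Complex.I) - (((t^2 * X ω^2) : ℝ):ℂ) / 2 := by
      intro ω; push_cast; ring
    simp_rw [e]
    have a3 : Integrable (fun ω => 1 + ((t * X ω : ℝ):ℂ) * Complex.I) P :=
      (integrable_const (1:ℂ)).add (a1.mul_const Complex.I)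
    rw [integral_sub a3 (a2.div_const 2),
      integral_add (integrable_const (1:ℂ)) (a1.mul_const Complex.I), integral_mul_const,
      integral_div, integral_complex_ofReal, integral_complex_ofReal, integral_const_mul, integral_const_mul, h0, ← hs]
    simp
  have h1 : ‖charFun (P.map X) t - ((1 - t^2 * s / 2 : ℝ) : ℂ)‖ ≤ |t|^3 * δ * s := by
    rw [hcf, ← hpint, ← integral_sub hexpi hpoly]
    calc _ ≤ ∫ ω, |t|^3 * δ * X ω ^ 2 ∂P := by
          refine norm_integral_le_of_norm_le (hX2.const_mul _) (ae_of_all _ fun ω => ?_)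
          have hb : |t * X ω| ≤ 1 := by
            rw [abs_mul]; exact (mul_le_mul_of_nonneg_left (hδ ω) (abs_nonneg _)).trans ht
          refine (exp_taylor3 _ hb).trans ?_
          rw [abs_mul, mul_pow, pow_succ (|X ω|), sq_abs, mul_assoc]
          have := hδ ω
          rw [mul_comm (X ω ^2)]
          gcongr
      _ = _ := by rw [integral_const_mul]
  have hu0 : 0 ≤ t^2 * s / 2 := by positivity
  have htδ : t^2 * δ^2 ≤ 1 := by
    rw [← sq_abs t, ← mul_pow]; exact pow_le_one₀ (by positivity) ht
  have hu1 : t^2 * s / 2 ≤ 1 := by nlinarith [mul_le_mul_of_nonneg_left hsδ (sq_nonneg t)]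
  have h2 : ‖((1 - t^2 * s / 2 : ℝ) : ℂ) - Complex.exp (-(t^2 * s / 2 : ℝ))‖ ≤ t^4 * δ^2 * s := by
    rw [← Complex.ofReal_neg, ← Complex.ofReal_exp, ← Complex.ofReal_sub, Complex.norm_real,
      Real.norm_eq_abs, abs_sub_comm]
    have := Real.abs_exp_sub_one_sub_id_le (x := -(t^2 * s/2)) (by rw [abs_neg, abs_of_nonneg hu0]; exact hu1)
    rw [show Real.exp (-(t^2*s/2)) - (1 - t^2*s/2) = Real.exp (-(t^2*s/2)) - 1 - -(t^2*s/2) by ring]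
    refine this.trans ?_
    have : t^4 * (s * s) ≤ t^4 * (δ^2 * s) := by gcongr
    nlinarith [mul_nonneg (by positivity : 0 ≤ t^4) (mul_self_nonneg s)]
  calc _ ≤ _ := norm_sub_le_norm_sub_add_norm_sub _ ((1 - t^2 * s / 2 : ℝ) : ℂ) _
    _ ≤ |t|^3 * δ * s + t^4 * δ^2 * s := add_le_add h1 h2
    _ = _ := by ring

lemma charFun_sum_bound {Ω : Type*} [MeasurableSpace Ω] (P : Measure Ω) [IsProbabilityMeasure P]
    {ι : Type*} [Fintype ι] (X : ι → Ω → ℝ) (hX : ∀ j, Measurable (X j)) (hind : iIndepFun X P)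
    (δ t : ℝ) (hδ : ∀ j ω, |X j ω| ≤ δ) (ht : |t| * δ ≤ 1)
    (h0 : ∀ j, ∫ ω, X j ω ∂P = 0) (h1 : ∑ j, ∫ ω, X j ω ^ 2 ∂P = 1) :
    ‖charFun (P.map (fun ω => ∑ j, X j ω)) t - charFun (gaussianReal 0 1) t‖ ≤
      (|t|^3 * δ + t^4 * δ^2) := by
  have hg : charFun (gaussianReal 0 1) t = ∏ j, Complex.exp (-(t^2 * (∫ ω, X j ω ^ 2 ∂P) / 2 : ℝ)) := by
    rw [charFun_gaussianReal, ← Complex.exp_sum]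
    congr 1
    rw [Finset.sum_neg_distrib, ← Complex.ofReal_sum, ← Finset.sum_div, ← Finset.mul_sum, h1]
    push_cast; simp
  rw [hg, iIndepFun.charFun_map_fun_sum_eq_prod (fun j => (hX j).aemeasurable) hind]
  simp only [Finset.prod_apply]
  refine (prod_sub_prod _ _ _ ?_ ?_).trans ?_
  · intro j
    have := Measure.isProbabilityMeasure_map (μ := P) (hX j).aemeasurable
    exact norm_charFun_le_one t
  · intro j
    rw [← Complex.ofReal_neg, Complex.norm_exp_ofReal]
    have : 0 ≤ ∫ ω, X j ω ^ 2 ∂P := integral_nonneg fun ω => sq_nonneg _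
    rw [Real.exp_le_one_iff]
    have : 0 ≤ t^2 * ∫ ω, X j ω ^ 2 ∂P := by positivity
    linarith
  · calc _ ≤ ∑ j, (|t|^3 * δ + t^4 * δ^2) * ∫ ω, X j ω ^ 2 ∂P :=
        Finset.sum_le_sum fun j _ => charFun_one P (X j) (hX j) δ t (hδ j) ht (h0 j)
      _ = _ := by rw [← Finset.mul_sum, h1, mul_one]

lemma tendsto_prob {Ω : ℕ → Type*} [∀ m, MeasurableSpace (Ω m)]
    (P : ∀ m, Measure (Ω m)) [∀ m, IsProbabilityMeasure (P m)] (T : ∀ m, Ω m → ℝ)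
    (hT : ∀ m, Measurable (T m))
    (h : ∀ t, Tendsto (fun m => charFun ((P m).map (T m)) t) atTop (𝓝 (charFun (gaussianReal 0 1) t)))
    (x : ℝ) : Tendsto (fun m => (P m {ω | |T m ω| ≤ x}).toReal) atTop
      (𝓝 ((gaussianReal 0 1 (Set.Icc (-x) x)).toReal)) := by
  have hp : ∀ m, IsProbabilityMeasure ((P m).map (T m)) := fun m =>
    Measure.isProbabilityMeasure_map (hT m).aemeasurable
  let μ : ℕ → ProbabilityMeasure ℝ := fun m => ⟨(P m).map (T m), hp m⟩
  let ν : ProbabilityMeasure ℝ := ⟨gaussianReal 0 1, inferInstance⟩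
  have hμ : Tendsto μ atTop (𝓝 ν) := ProbabilityMeasure.tendsto_iff_tendsto_charFun.2 h
  have : NullSingletonClass (gaussianReal 0 1) := nullSingletonClass_gaussianReal one_ne_zero
  have := ProbabilityMeasure.tendsto_measure_of_null_frontier_of_tendsto' hμ (E := Set.Icc (-x) x) (by
    change gaussianReal 0 1 _ = 0
    refine measure_mono_null (t := {-x, x}) ?_ ((Set.toFinite _).measure_zero _)
    by_cases hx : -x ≤ x
    · rw [frontier_Icc hx]
    · rw [Set.Icc_eq_empty hx]; simp)
  have h2 := (ENNReal.tendsto_toReal (measure_ne_top (gaussianReal 0 1) _)).comp this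
  refine h2.congr fun m => ?_
  simp only [Function.comp]
  change ((P m).map (T m) (Set.Icc (-x) x)).toReal = _
  rw [Measure.map_apply (hT m) measurableSet_Icc]
  congr 2
  ext ω; simp [abs_le]

lemma liminf_nonneg_iff (f : ℕ → ℝ) (C : ℝ) (hC : ∀ᶠ m in atTop, C ≤ f m) :
    0 ≤ liminf f atTop ↔ ∀ ε > 0, ∀ᶠ m in atTop, -ε ≤ f m := by
  constructor
  · intro h ε hε
    have := exists_lt_of_lt_csSup (s := {a | ∀ᶠ n in atTop, a ≤ f n}) (b := -ε) ⟨C, hC⟩ (by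
      rw [← liminf_eq]; linarith)
    obtain ⟨a, ha, hb⟩ := this
    filter_upwards [ha] with m hm
    linarith
  · intro h
    rw [liminf_eq]
    by_cases hb : BddAbove {a | ∀ᶠ n in atTop, a ≤ f n}
    · refine le_of_forall_pos_le_add fun ε hε => ?_
      have := le_csSup hb (h ε hε)
      linarith
    · rw [Real.sSup_of_not_bddAbove hb]

/-- probability of a symmetric interval -/
def G (x : ℝ) : ℝ := (gaussianReal 0 1 (Set.Icc (-x) x)).toReal

lemma G_eq (x : ℝ) (hx : 0 ≤ x) : G x = 2 * (gaussianReal 0 1 (Set.Iic x)).toReal - 1 := by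
  have : NullSingletonClass (gaussianReal 0 1) := nullSingletonClass_gaussianReal one_ne_zero
  have hneg : (gaussianReal 0 1) (Set.Iio (-x)) = gaussianReal 0 1 (Set.Ioi x) := by
    have := gaussianReal_map_neg (μ := 0) (v := 1)
    rw [neg_zero] at this
    conv_lhs => rw [← this]
    rw [Measure.map_apply measurable_neg measurableSet_Iio]
    congr 1; ext y; simp
  have hu : Set.Iic x = Set.Iio (-x) ∪ Set.Icc (-x) x := by
    ext y; simp only [Set.mem_Iic, Set.mem_union, Set.mem_Iio, Set.mem_Icc]
    constructor
    · intro h; rcases lt_or_ge y (-x) with h' | h'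
      · exact Or.inl h'
      · exact Or.inr ⟨h', h⟩
    · rintro (h | h)
      · linarith
      · exact h.2
  have h1 : (gaussianReal 0 1).real (Set.Iic x) = (gaussianReal 0 1).real (Set.Iio (-x)) + (gaussianReal 0 1).real (Set.Icc (-x) x) := by
    rw [hu, measureReal_union _ measurableSet_Icc]
    rw [Set.disjoint_left]; intro y hy hy'; simp at hy hy'; linarith
  have h2 : (gaussianReal 0 1).real (Set.Iic x) + (gaussianReal 0 1).real (Set.Ioi x) = 1 := by
    rw [← Set.compl_Iic, measureReal_add_measureReal_compl measurableSet_Iic]; simp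
  have h3 : (gaussianReal 0 1).real (Set.Iio (-x)) = (gaussianReal 0 1).real (Set.Ioi x) := by
    simp [measureReal_def, hneg]
  change (gaussianReal 0 1).real (Set.Icc (-x) x) = 2 * (gaussianReal 0 1).real (Set.Iic x) - 1
  linarith

lemma Ioc_pos (a b : ℝ) (h : a < b) : 0 < (gaussianReal 0 1).real (Set.Ioc a b) := by
  have : (volume : Measure ℝ) ≪ gaussianReal 0 1 := gaussianReal_absolutelyContinuous' 0 one_ne_zero
  rw [measureReal_def]
  refine ENNReal.toReal_pos (fun h0 => ?_) (measure_ne_top _ _)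
  have := this h0
  simp at this; linarith

lemma G_strict (x y : ℝ) (hx : 0 ≤ x) (h : x < y) : G x < G y := by
  rw [G_eq x hx, G_eq y (hx.trans h.le)]
  have := Ioc_pos x y h
  have h1 : (gaussianReal 0 1).real (Set.Iic y) = (gaussianReal 0 1).real (Set.Iic x) + (gaussianReal 0 1).real (Set.Ioc x y) := by
    rw [← measureReal_union _ measurableSet_Ioc, Set.Iic_union_Ioc_eq_Iic h.le]
    rw [Set.disjoint_left]; intro y hy hy'; simp at hy hy'; linarith
  simp only [measureReal_def] at *
  linarith

lemma G_approx (z : ℝ) (hz : 0 < z) (η : ℝ) (hη : 0 < η) : ∃ x, 0 ≤ x ∧ x < z ∧ G z - η < G x := by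
  have : NullSingletonClass (gaussianReal 0 1) := nullSingletonClass_gaussianReal one_ne_zero
  obtain ⟨u, hu, hlt, hlim⟩ := exists_seq_strictMono_tendsto z
  have h : Tendsto (fun n => gaussianReal 0 1 (Set.Ioc (u n) z)) atTop (𝓝 0) := by
    have h1 := tendsto_measure_iInter_atTop (μ := gaussianReal 0 1) (s := fun n => Set.Ioc (u n) z)
      (fun n => measurableSet_Ioc.nullMeasurableSet)
      (fun a b hab => Set.Ioc_subset_Ioc_left (hu.monotone hab)) ⟨0, measure_ne_top _ _⟩
    have h2 : gaussianReal 0 1 (⋂ n, Set.Ioc (u n) z) = 0 := by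
      refine measure_mono_null (t := {z}) ?_ (measure_singleton z)
      intro y hy
      simp only [Set.mem_iInter, Set.mem_Ioc] at hy
      exact le_antisymm (hy 0).2 (le_of_tendsto' hlim fun n => (hy n).1.le)
    rwa [h2] at h1
  have h2 : ∀ᶠ n in atTop, gaussianReal 0 1 (Set.Ioc (u n) z) < ENNReal.ofReal (η/2) :=
    h.eventually_lt_const (by simpa using hη)
  have h3 : ∀ᶠ n in atTop, 0 < u n := hlim.eventually_const_lt hz
  obtain ⟨n, hx, hx0⟩ := (h2.and h3).exists
  have hxz := hlt n
  set x := u n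
  refine ⟨x, hx0.le, hxz, ?_⟩
  rw [G_eq x hx0.le, G_eq z hz.le]
  have h1 : (gaussianReal 0 1).real (Set.Iic z) = (gaussianReal 0 1).real (Set.Iic x) + (gaussianReal 0 1).real (Set.Ioc x z) := by
    rw [← measureReal_union _ measurableSet_Ioc, Set.Iic_union_Ioc_eq_Iic hxz.le]
    rw [Set.disjoint_left]; intro y hy hy'; simp at hy hy'; linarith
  have h4 := (ENNReal.lt_ofReal_iff_toReal_lt (measure_ne_top _ _)).1 hx
  simp only [measureReal_def] at *
  linarith

lemma assignSet_nonempty (k ℓ : ℕ) (h : ℓ ≤ k) : (assignSet k ℓ).Nonempty := by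
  obtain ⟨s, _, hs⟩ := Finset.exists_subset_card_eq (s := (Finset.univ : Finset (Fin k))) (n := ℓ) (by simpa using h)
  refine ⟨fun i => decide (i ∈ s), ?_⟩
  simp [assignSet, hs]

lemma uniform_prob (k ℓ : ℕ) (h : ℓ ≤ k) : IsProbabilityMeasure (uniformFinset (assignSet k ℓ)) := by
  constructor
  have := assignSet_nonempty k ℓ h
  have hc : ((assignSet k ℓ).card : ENNReal) ≠ 0 := by
    simpa using this.ne_empty
  simp only [uniformFinset, Measure.smul_apply, Measure.finsetSum_apply, measure_univ, smul_eq_mul]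
  rw [Finset.sum_const, nsmul_eq_mul, mul_one, ENNReal.inv_mul_cancel hc (by simp)]

lemma count_swap (k ℓ : ℕ) (i i' : Fin k) :
    ((assignSet k ℓ).filter fun d => d i = true).card ≤ ((assignSet k ℓ).filter fun d => d i' = true).card := by
  refine Finset.card_le_card_of_injOn (fun d => d ∘ Equiv.swap i i') ?_ ?_
  · intro d hd
    simp only [assignSet, Finset.coe_filter, Finset.mem_filter, Finset.mem_univ, true_and, Set.mem_ofPred_eq, Function.comp] at hd ⊢
    refine ⟨?_, by simpa using hd.2⟩
    rw [← hd.1]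
    refine Finset.card_bij (fun a _ => Equiv.swap i i' a) ?_ ?_ ?_
    · intro a ha; simpa using ha
    · intro a _ b _ h; simpa using h
    · intro b hb; exact ⟨Equiv.swap i i' b, by simpa using hb, by simp⟩
  · intro d _ d' _ h
    funext a
    have := congrFun h (Equiv.swap i i' a)
    simpa using this

lemma count_eq (k ℓ : ℕ) (i : Fin k) :
    (k : ℝ) * ((assignSet k ℓ).filter fun d => d i = true).card = ℓ * (assignSet k ℓ).card := by
  have h : ∑ i' : Fin k, ((assignSet k ℓ).filter fun d => d i' = true).card = ∑ d ∈ assignSet k ℓ, ℓ := by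
    simp_rw [Finset.card_filter]
    rw [Finset.sum_comm]
    refine Finset.sum_congr rfl fun d hd => ?_
    rw [← Finset.card_filter]
    simpa [assignSet] using hd
  have h2 : ∀ i' : Fin k, ((assignSet k ℓ).filter fun d => d i' = true).card = ((assignSet k ℓ).filter fun d => d i = true).card :=
    fun i' => le_antisymm (count_swap _ _ _ _) (count_swap _ _ _ _)
  simp_rw [h2] at h
  simp only [Finset.sum_const, Finset.card_univ, Fintype.card_fin, smul_eq_mul] at h
  rw [mul_comm (ℓ : ℝ)]
  exact_mod_cast h

lemma integral_uniform (k ℓ : ℕ) (f : (Fin k → Bool) → ℝ) :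
    ∫ d, f d ∂(uniformFinset (assignSet k ℓ)) = ((assignSet k ℓ).card : ℝ)⁻¹ * ∑ d ∈ assignSet k ℓ, f d := by
  rw [uniformFinset, integral_smul_measure, integral_finsetSum_measure (fun d _ => Integrable.of_finite)]
  simp

section fixed
set_option linter.unusedSectionVars false
variable {Ω' : Type*} [MeasurableSpace Ω'] (P : Measure Ω') [IsProbabilityMeasure P] (m k ℓ : ℕ)
  (Y1 Y0 : Fin m → Fin k → ℝ) (D : Ω' → Fin m → Fin k → Bool)

def gJ (j : Fin m) (d : Fin k → Bool) : ℝ :=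
  (ℓ : ℝ)⁻¹ * ∑ i, (if d i then Y1 j i else 0)
    - ((k : ℝ) - ℓ)⁻¹ * ∑ i, (if d i then 0 else Y0 j i)

lemma hatDeltaJ_eq (j : Fin m) :
    hatDeltaJ m k ℓ Y1 Y0 D j = fun ω => gJ m k ℓ Y1 Y0 j (D ω j) := rfl

lemma map_coord (hℓk : ℓ < k) (hD : Assumption1 P m k ℓ D) (j : Fin m) :
    P.map (fun ω => D ω j) = uniformFinset (assignSet k ℓ) := by
  have := uniform_prob k ℓ hℓk.le
  have h := (measurePreserving_eval (fun _ : Fin m => uniformFinset (assignSet k ℓ)) j).map_eq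
  rw [← hD.2, Measure.map_map (measurable_pi_apply j) hD.1] at h
  exact h

lemma meas_hatDeltaJ (hD : Assumption1 P m k ℓ D) (j : Fin m) :
    Measurable (hatDeltaJ m k ℓ Y1 Y0 D j) := by
  rw [hatDeltaJ_eq]
  exact (Measurable.of_discrete (f := gJ m k ℓ Y1 Y0 j)).comp ((measurable_pi_apply j).comp hD.1)

lemma integral_hatDeltaJ (hℓ : 0 < ℓ) (hℓk : ℓ < k) (hD : Assumption1 P m k ℓ D) (j : Fin m) :
    ∫ ω, hatDeltaJ m k ℓ Y1 Y0 D j ω ∂P = DeltaJ m k Y1 Y0 j := by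
  have hm : Measurable fun ω => D ω j := (measurable_pi_apply j).comp hD.1
  have h1 : ∫ ω, hatDeltaJ m k ℓ Y1 Y0 D j ω ∂P = ∫ d, gJ m k ℓ Y1 Y0 j d ∂(P.map (fun ω => D ω j)) := by
    rw [integral_map hm.aemeasurable Measurable.of_discrete.aestronglyMeasurable]
    rfl
  rw [h1, map_coord P m k ℓ D hℓk hD j, integral_uniform]
  set S := assignSet k ℓ
  have hS : (S.card : ℝ) ≠ 0 := by
    have := (assignSet_nonempty k ℓ hℓk.le).card_pos
    exact_mod_cast this.ne'
  have hk0 : (k : ℝ) ≠ 0 := by have : 0 < k := by omega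
                               exact_mod_cast this.ne'
  have hl0 : (ℓ : ℝ) ≠ 0 := by exact_mod_cast hℓ.ne'
  have hkl : (k : ℝ) - ℓ ≠ 0 := by
    have : (ℓ : ℝ) < k := by exact_mod_cast hℓk
    linarith
  have hN : ∀ i : Fin k, ((S.filter fun d => d i = true).card : ℝ) = ℓ / k * S.card := by
    intro i
    have := count_eq k ℓ i
    field_simp
    linarith
  have e1 : ∀ i, ∑ d ∈ S, (if d i = true then Y1 j i else 0) = ℓ / k * S.card * Y1 j i := by
    intro i
    rw [← Finset.sum_filter, Finset.sum_const, nsmul_eq_mul, hN]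
  have e0 : ∀ i, ∑ d ∈ S, (if d i = true then 0 else Y0 j i) = (1 - ℓ / k) * S.card * Y0 j i := by
    intro i
    have : ∀ d : Fin k → Bool, (if d i = true then 0 else Y0 j i) = Y0 j i - (if d i = true then Y0 j i else 0) := by
      intro d; split_ifs <;> simp
    simp_rw [this]
    rw [Finset.sum_sub_distrib, ← Finset.sum_filter, Finset.sum_const, Finset.sum_const, nsmul_eq_mul, nsmul_eq_mul, hN]
    ring
  simp only [gJ, DeltaJ]
  rw [Finset.sum_sub_distrib, ← Finset.mul_sum, ← Finset.mul_sum, Finset.sum_comm, Finset.sum_comm (s := S)]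
  simp_rw [e1, e0]
  rw [← Finset.mul_sum, ← Finset.mul_sum, Finset.sum_sub_distrib]
  field_simp

lemma hatDelta_sum (ω : Ω') : hatDelta m k ℓ Y1 Y0 D ω = (m:ℝ)⁻¹ * ∑ j, hatDeltaJ m k ℓ Y1 Y0 D j ω := by
  simp only [hatDelta, hatDeltaJ, Finset.sum_sub_distrib, ← Finset.mul_sum, mul_inv]
  ring

lemma Delta_sum : Delta m k Y1 Y0 = (m:ℝ)⁻¹ * ∑ j, DeltaJ m k Y1 Y0 j := by
  simp only [Delta, DeltaJ, ← Finset.mul_sum, mul_inv]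
  ring

lemma indep_hatDeltaJ (hℓk : ℓ < k) (hD : Assumption1 P m k ℓ D) :
    iIndepFun (fun j => fun ω => D ω j) P := by
  have hm : ∀ j, AEMeasurable (fun ω => D ω j) P :=
    fun j => ((measurable_pi_apply j).comp hD.1).aemeasurable
  rw [iIndepFun_iff_map_fun_eq_pi_map hm]
  simp_rw [map_coord P m k ℓ D hℓk hD]
  exact hD.2

lemma bound_hatDeltaJ (hℓ : 0 < ℓ) (hℓk : ℓ < k) (M : ℝ) (h1 : ∀ j i, |Y1 j i| ≤ M)
    (h0 : ∀ j i, |Y0 j i| ≤ M) (j : Fin m) (ω : Ω') :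
    |hatDeltaJ m k ℓ Y1 Y0 D j ω - DeltaJ m k Y1 Y0 j| ≤ 4 * k * M := by
  have hM : 0 ≤ M := (abs_nonneg _).trans (h1 j ⟨0, by omega⟩)
  have hk1 : (1:ℝ) ≤ k := by exact_mod_cast (by omega : 1 ≤ k)
  have hl1 : (ℓ:ℝ)⁻¹ ≤ 1 := inv_le_one_of_one_le₀ (by exact_mod_cast hℓ)
  have hkl1 : ((k:ℝ) - ℓ)⁻¹ ≤ 1 := inv_le_one_of_one_le₀ (by
    have : (ℓ:ℝ) + 1 ≤ k := by exact_mod_cast hℓk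
    linarith)
  have hl0 : 0 ≤ (ℓ:ℝ)⁻¹ := by positivity
  have hkl0 : 0 ≤ ((k:ℝ) - ℓ)⁻¹ := inv_nonneg.2 (by
    have : (ℓ:ℝ) ≤ k := by exact_mod_cast hℓk.le
    linarith)
  have hki0 : 0 ≤ (k:ℝ)⁻¹ := by positivity
  have hki1 : (k:ℝ)⁻¹ ≤ 1 := inv_le_one_of_one_le₀ hk1
  have s : ∀ (f : Fin k → ℝ) (B : ℝ), (∀ i, |f i| ≤ B) → |∑ i, f i| ≤ k * B := by
    intro f B hf
    refine (Finset.abs_sum_le_sum_abs _ _).trans ?_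
    refine (Finset.sum_le_sum fun i _ => hf i).trans ?_
    simp
  have p : ∀ c x B : ℝ, 0 ≤ c → c ≤ 1 → |x| ≤ B → |c * x| ≤ B := by
    intro c x B hc hc1 hx
    rw [abs_mul, abs_of_nonneg hc]
    exact (mul_le_of_le_one_left (abs_nonneg _) hc1).trans hx
  have a1 := p _ _ _ hl0 hl1 (s (fun i => if D ω j i then Y1 j i else 0) M (fun i => by
    split_ifs
    · exact h1 j i
    · simpa using hM))
  have a2 := p _ _ _ hkl0 hkl1 (s (fun i => if D ω j i then 0 else Y0 j i) M (fun i => by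
    split_ifs
    · simpa using hM
    · exact h0 j i))
  have a3 := p _ _ _ hki0 hki1 (s (fun i => Y1 j i - Y0 j i) (2 * M) (fun i => by
    refine (abs_sub _ _).trans ?_
    linarith [h1 j i, h0 j i]))
  rw [hatDeltaJ, DeltaJ]
  rw [abs_le] at *
  constructor <;> linarith

lemma charFun_design (hm : 0 < m) (hℓ : 0 < ℓ) (hℓk : ℓ < k) (hD : Assumption1 P m k ℓ D)
    (M : ℝ) (h1 : ∀ j i, |Y1 j i| ≤ M) (h0 : ∀ j i, |Y0 j i| ≤ M)
    (v : ℝ) (hv : v = variance (hatDelta m k ℓ Y1 Y0 D) P) (hv0 : 0 < v) (t δ : ℝ)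
    (hδ : δ = ((m:ℝ) * √v)⁻¹ * (4 * k * M)) (ht : |t| * δ ≤ 1) :
    ‖charFun (P.map (fun ω => (√v)⁻¹ * (hatDelta m k ℓ Y1 Y0 D ω - Delta m k Y1 Y0))) t
      - charFun (gaussianReal 0 1) t‖ ≤ |t|^3 * δ + t^4 * δ^2 := by
  set a := ((m:ℝ) * √v)⁻¹ with ha
  have ha0 : 0 ≤ a := by positivity
  set X : Fin m → Ω' → ℝ := fun j ω => a * (hatDeltaJ m k ℓ Y1 Y0 D j ω - DeltaJ m k Y1 Y0 j) with hXd
  have hXm : ∀ j, Measurable (X j) := fun j =>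
    ((meas_hatDeltaJ P m k ℓ Y1 Y0 D hD j).sub_const _).const_mul _
  have hXb : ∀ j ω, |X j ω| ≤ δ := by
    intro j ω
    rw [hXd, hδ, abs_mul, abs_of_nonneg ha0]
    exact mul_le_mul_of_nonneg_left (bound_hatDeltaJ m k ℓ Y1 Y0 D hℓ hℓk M h1 h0 j ω) ha0
  have hind : iIndepFun X P :=
    (indep_hatDeltaJ P m k ℓ D hℓk hD).comp
      (fun j d => a * (gJ m k ℓ Y1 Y0 j d - DeltaJ m k Y1 Y0 j)) (fun j => Measurable.of_discrete)
  have hLp : ∀ j, MemLp (X j) 2 P := fun j =>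
    MemLp.of_bound (hXm j).aestronglyMeasurable δ (ae_of_all _ (hXb j))
  have hsum : (fun ω => ∑ j, X j ω) = fun ω => (√v)⁻¹ * (hatDelta m k ℓ Y1 Y0 D ω - Delta m k Y1 Y0) := by
    funext ω
    rw [hatDelta_sum, Delta_sum]
    simp only [hXd]
    rw [← Finset.mul_sum, Finset.sum_sub_distrib, ha, mul_inv]
    ring
  have hmeanJ : ∀ j, ∫ ω, X j ω ∂P = 0 := by
    intro j
    have hi : Integrable (hatDeltaJ m k ℓ Y1 Y0 D j) P := by
      refine Integrable.of_bound (meas_hatDeltaJ P m k ℓ Y1 Y0 D hD j).aestronglyMeasurable (4 * k * M + |DeltaJ m k Y1 Y0 j|) (ae_of_all _ fun ω => ?_)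
      have := bound_hatDeltaJ m k ℓ Y1 Y0 D hℓ hℓk M h1 h0 j ω
      have h3 := abs_sub_abs_le_abs_sub (hatDeltaJ m k ℓ Y1 Y0 D j ω) (DeltaJ m k Y1 Y0 j)
      rw [Real.norm_eq_abs]; linarith
    simp only [hXd]
    rw [integral_const_mul, integral_sub hi (integrable_const _), integral_hatDeltaJ P m k ℓ Y1 Y0 D hℓ hℓk hD]
    simp
  have hmeasD : Measurable (hatDelta m k ℓ Y1 Y0 D) := by
    have : hatDelta m k ℓ Y1 Y0 D = fun ω => (m:ℝ)⁻¹ * ∑ j, hatDeltaJ m k ℓ Y1 Y0 D j ω :=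
      funext (hatDelta_sum m k ℓ Y1 Y0 D)
    rw [this]
    exact (Finset.measurable_sum _ fun j _ => meas_hatDeltaJ P m k ℓ Y1 Y0 D hD j).const_mul _
  have hvar : ∑ j, ∫ ω, X j ω ^ 2 ∂P = 1 := by
    have e : ∀ j, ∫ ω, X j ω ^ 2 ∂P = variance (X j) P := fun j =>
      (variance_of_integral_eq_zero (hXm j).aemeasurable (hmeanJ j)).symm
    simp_rw [e]
    rw [← IndepFun.variance_sum (fun j _ => hLp j) (fun i _ j _ hij => hind.indepFun hij)]
    have : (∑ j, X j) = fun ω => (√v)⁻¹ * (hatDelta m k ℓ Y1 Y0 D ω - Delta m k Y1 Y0) := by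
      rw [← hsum]; funext ω; simp
    rw [this, variance_const_mul, variance_sub_const hmeasD.aestronglyMeasurable, ← hv, inv_pow, Real.sq_sqrt hv0.le, inv_mul_cancel₀ hv0.ne']
  rw [← hsum]
  exact charFun_sum_bound P X hXm hind δ t hXb ht hmeanJ hvar

lemma meas_hatDelta (hD : Assumption1 P m k ℓ D) : Measurable (hatDelta m k ℓ Y1 Y0 D) := by
  have : hatDelta m k ℓ Y1 Y0 D = fun ω => (m:ℝ)⁻¹ * ∑ j, hatDeltaJ m k ℓ Y1 Y0 D j ω :=
    funext (hatDelta_sum m k ℓ Y1 Y0 D)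
  rw [this]
  exact (Finset.measurable_sum _ fun j _ => meas_hatDeltaJ P m k ℓ Y1 Y0 D hD j).const_mul _

lemma sup_bound (j : Fin m) (i : Fin k) (d : Bool) :
    (if d then Y1 j i else Y0 j i) ^ 2 ≤
      ⨆ j : Fin m, ⨆ i : Fin k, ⨆ d : Bool, (if d then Y1 j i else Y0 j i) ^ 2 := by
  refine le_trans ?_ (le_ciSup (Set.finite_range _).bddAbove j)
  refine le_trans ?_ (le_ciSup (Set.finite_range _).bddAbove i)
  exact le_ciSup (f := fun d : Bool => (if d then Y1 j i else Y0 j i) ^ 2) (Set.finite_range _).bddAbove d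
end fixed

lemma le_liminf_iff' (f : ℕ → ℝ) (a : ℝ) (h0 : ∀ m, 0 ≤ f m) (h1 : ∀ m, f m ≤ 1) :
    a ≤ liminf f atTop ↔ ∀ ε > 0, ∀ᶠ m in atTop, a - ε ≤ f m := by
  have hb : BddAbove {a | ∀ᶠ n in atTop, a ≤ f n} := by
    refine ⟨1, fun b hb => ?_⟩
    obtain ⟨n, hn⟩ := Filter.Eventually.exists (f := atTop) hb
    exact hn.trans (h1 n)
  constructor
  · intro h ε hε
    obtain ⟨b, hb, hb'⟩ := exists_lt_of_lt_csSup (s := {a | ∀ᶠ n in atTop, a ≤ f n}) (b := a - ε)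
      ⟨0, Eventually.of_forall h0⟩ (by rw [← liminf_eq]; linarith)
    filter_upwards [hb] with m hm
    linarith
  · intro h
    rw [liminf_eq]
    refine le_of_forall_pos_le_add fun ε hε => ?_
    have := le_csSup hb (h ε hε)
    linarith

lemma tendsto_charFun_design (k ℓ : ℕ) (hℓ : 0 < ℓ) (hℓk : ℓ < k)
    (Ω : ℕ → Type*) [∀ m, MeasurableSpace (Ω m)]
    (P : ∀ m, Measure (Ω m)) [∀ m, IsProbabilityMeasure (P m)]
    (Y1 Y0 : (m : ℕ) → Fin m → Fin k → ℝ)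
    (D : (m : ℕ) → Ω m → Fin m → Fin k → Bool)
    (hD : ∀ m, Assumption1 (P m) m k ℓ (D m))
    (hY : Tendsto (fun m : ℕ =>
        ((m : ℝ) * k)⁻¹ * ⨆ j : Fin m, ⨆ i : Fin k, ⨆ d : Bool,
          (if d then Y1 m j i else Y0 m j i) ^ 2) atTop (𝓝 0))
    (c : ℝ) (hc : 0 < c) (hv : ∀ᶠ m : ℕ in atTop, c ≤
        (m : ℝ) * k * variance (hatDelta m k ℓ (Y1 m) (Y0 m) (D m)) (P m)) (t : ℝ) :
    Tendsto (fun m => charFun ((P m).map (fun ω =>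
      (√(variance (hatDelta m k ℓ (Y1 m) (Y0 m) (D m)) (P m)))⁻¹ *
        (hatDelta m k ℓ (Y1 m) (Y0 m) (D m) ω - Delta m k (Y1 m) (Y0 m)))) t) atTop
      (𝓝 (charFun (gaussianReal 0 1) t)) := by
  set v : ℕ → ℝ := fun m => variance (hatDelta m k ℓ (Y1 m) (Y0 m) (D m)) (P m) with hvd
  set S : ℕ → ℝ := fun m => ⨆ j : Fin m, ⨆ i : Fin k, ⨆ d : Bool,
          (if d then Y1 m j i else Y0 m j i) ^ 2 with hS
  set δ : ℕ → ℝ := fun m => ((m:ℝ) * √(v m))⁻¹ * (4 * k * √(S m)) with hδ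
  have hk : (0:ℝ) < k := by exact_mod_cast (by omega : 0 < k)
  have hS0 : ∀ m, 0 ≤ S m := fun m =>
    Real.iSup_nonneg fun j => Real.iSup_nonneg fun i => Real.iSup_nonneg fun d => sq_nonneg _
  have hδ0 : ∀ m, 0 ≤ δ m := fun m => by positivity
  have hδsq : ∀ᶠ m in atTop, δ m ^ 2 ≤ 16 * k^4 / c * (((m:ℝ) * k)⁻¹ * S m) := by
    filter_upwards [hv, eventually_gt_atTop 0] with m hm hm0
    have hmp : (0:ℝ) < m := by exact_mod_cast hm0
    have hvp : 0 < v m := by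
      have : 0 < (m:ℝ) * k * v m := hc.trans_le hm
      exact pos_of_mul_pos_right this (by positivity)
    have e : δ m ^ 2 = 16 * k^4 / ((m:ℝ) * k * v m) * (((m:ℝ) * k)⁻¹ * S m) := by
      simp only [hδ]
      rw [mul_pow, inv_pow, mul_pow, mul_pow, Real.sq_sqrt hvp.le, Real.sq_sqrt (hS0 m)]
      field_simp
      ring
    rw [e]
    have := hS0 m
    gcongr
  have hδ2 : Tendsto (fun m => δ m ^ 2) atTop (𝓝 0) := by
    have := hY.const_mul (16 * k^4 / c)
    rw [mul_zero] at this
    exact squeeze_zero' (Eventually.of_forall fun m => sq_nonneg _) hδsq this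
  have hδ1 : Tendsto δ atTop (𝓝 0) := by
    have := (Real.continuous_sqrt.tendsto 0).comp hδ2
    rw [Real.sqrt_zero] at this
    refine this.congr fun m => ?_
    simp [Real.sqrt_sq (hδ0 m)]
  have htδ : ∀ᶠ m in atTop, |t| * δ m ≤ 1 := by
    have := hδ1.const_mul |t|
    rw [mul_zero] at this
    exact this.eventually_le_const one_pos
  rw [tendsto_iff_norm_sub_tendsto_zero]
  have hlim : Tendsto (fun m => |t|^3 * δ m + t^4 * δ m ^ 2) atTop (𝓝 0) := by
    simpa using (hδ1.const_mul (|t|^3)).add (hδ2.const_mul (t^4))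
  refine squeeze_zero' (Eventually.of_forall fun m => norm_nonneg _) ?_ hlim
  filter_upwards [hv, htδ, eventually_gt_atTop 0] with m hm htm hm0
  have hvp : 0 < v m := by
    have : 0 < (m:ℝ) * k * v m := hc.trans_le hm
    exact pos_of_mul_pos_right this (by positivity)
  exact charFun_design (P m) m k ℓ (Y1 m) (Y0 m) (D m) hm0 hℓ hℓk (hD m) (√(S m))
    (fun j i => Real.abs_le_sqrt (sup_bound m k (Y1 m) (Y0 m) j i true))
    (fun j i => Real.abs_le_sqrt (sup_bound m k (Y1 m) (Y0 m) j i false))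
    (v m) rfl hvp t (δ m) rfl htm

lemma z_pos (α z : ℝ) (hα1 : α < 1) (hz : stdNormCDF z = 1 - α / 2) : 0 < z ∧ G z = 1 - α := by
  have hz0 : 0 < z := by
    by_contra h
    push Not at h
    have : NullSingletonClass (gaussianReal 0 1) := nullSingletonClass_gaussianReal one_ne_zero
    have h0 : G 0 = 0 := by simp [G]
    rw [G_eq 0 le_rfl] at h0
    have : stdNormCDF z ≤ (gaussianReal 0 1 (Set.Iic 0)).toReal :=
      ENNReal.toReal_mono (measure_ne_top _ _) (measure_mono (Set.Iic_subset_Iic.2 h))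
    linarith
  refine ⟨hz0, ?_⟩
  rw [G_eq z hz0.le]
  rw [stdNormCDF] at hz
  linarith

lemma diff_bound {Ω' : Type*} [MeasurableSpace Ω'] (P : Measure Ω') [IsProbabilityMeasure P]
    (A B C : Set Ω') (h : ∀ ω, ω ∈ A → ω ∉ B → ω ∈ C) : (P A).toReal ≤ (P C).toReal + (P B).toReal := by
  have h1 : P A ≤ P C + P B := by
    refine (measure_mono (fun ω hω => ?_)).trans (measure_union_le C B)
    by_cases hb : ω ∈ B
    · exact Or.inr hb
    · exact Or.inl (h ω hω hb)
  rw [← ENNReal.toReal_add (measure_ne_top _ _) (measure_ne_top _ _)]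
  exact ENNReal.toReal_mono (by simp) h1

lemma T_le_iff (v x a : ℝ) (hv : 0 < v) : |(√v)⁻¹ * a| ≤ x ↔ |a| ≤ √v * x := by
  have : 0 < √v := Real.sqrt_pos.2 hv
  rw [abs_mul, abs_of_pos (inv_pos.2 this), inv_mul_le_iff₀ this]

/-- In the design-based stratified setup under Assumption 1, with
`(1/n)·max_{d,i} Yᵢ(d)² → 0`, `n·Var[Δ̂ₙ]` bounded away from 0 and bounded above, and
`Ṽₙ` a nonnegative variance estimator with `n·|Ṽₙ − E[Ṽₙ]| → 0` in probability, the
normal-based confidence intervals are asymptotically valid, i.e.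
`liminf P{Δ̂ₙ − √Ṽₙ z ≤ Δₙ ≤ Δ̂ₙ + √Ṽₙ z} ≥ 1 − α` where `Φ(z) = 1 − α/2`, if and only
if `Ṽₙ` is asymptotically upward-biased: `liminf n(E[Ṽₙ] − Var[Δ̂ₙ]) ≥ 0`. -/
theorem valid_iff_asymptotically_upward_biased (k ℓ : ℕ) (hℓ : 0 < ℓ) (hℓk : ℓ < k)
    (Ω : ℕ → Type*) [∀ m, MeasurableSpace (Ω m)]
    (P : ∀ m, Measure (Ω m)) [∀ m, IsProbabilityMeasure (P m)]
    (Y1 Y0 : (m : ℕ) → Fin m → Fin k → ℝ)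
    (D : (m : ℕ) → Ω m → Fin m → Fin k → Bool)
    (hD : ∀ m, Assumption1 (P m) m k ℓ (D m))
    -- (i) (1/n)·max_{d ∈ {0,1}} max_{1≤i≤n} Yᵢ(d)² → 0
    (hY : Tendsto (fun m : ℕ =>
        ((m : ℝ) * k)⁻¹ * ⨆ j : Fin m, ⨆ i : Fin k, ⨆ d : Bool,
          (if d then Y1 m j i else Y0 m j i) ^ 2) atTop (𝓝 0))
    -- (ii) 0 < liminf n·Var[Δ̂ₙ] ≤ limsup n·Var[Δ̂ₙ] < ∞
    (hVarPos : 0 < liminf (fun m : ℕ =>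
        (m : ℝ) * k * variance (hatDelta m k ℓ (Y1 m) (Y0 m) (D m)) (P m)) atTop)
    (hVarBdd : IsBoundedUnder (· ≤ ·) atTop (fun m : ℕ =>
        (m : ℝ) * k * variance (hatDelta m k ℓ (Y1 m) (Y0 m) (D m)) (P m)))
    -- (iii) Ṽₙ nonnegative, integrable, with n·|Ṽₙ − E[Ṽₙ]| → 0 in probability
    (Vtil : (m : ℕ) → Ω m → ℝ)
    (hVmeas : ∀ m, Measurable (Vtil m)) (hVint : ∀ m, Integrable (Vtil m) (P m))
    (hVnonneg : ∀ m ω, 0 ≤ Vtil m ω)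
    (hVcons : ∀ ε : ℝ, 0 < ε → Tendsto (fun m : ℕ =>
        P m {ω | ε ≤ (m : ℝ) * k * |Vtil m ω - ∫ ω', Vtil m ω' ∂P m|})
      atTop (𝓝 0))
    -- the nominal level and normal quantile
    (α z : ℝ) (hα : 0 < α) (hα1 : α < 1) (hz : stdNormCDF z = 1 - α / 2) :
    (1 - α ≤ liminf (fun m : ℕ =>
        (P m {ω | hatDelta m k ℓ (Y1 m) (Y0 m) (D m) ω - Real.sqrt (Vtil m ω) * z
                    ≤ Delta m k (Y1 m) (Y0 m) ∧
                  Delta m k (Y1 m) (Y0 m)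
                    ≤ hatDelta m k ℓ (Y1 m) (Y0 m) (D m) ω + Real.sqrt (Vtil m ω) * z}).toReal)
      atTop)
    ↔ (0 ≤ liminf (fun m : ℕ =>
        (m : ℝ) * k * ((∫ ω', Vtil m ω' ∂P m)
          - variance (hatDelta m k ℓ (Y1 m) (Y0 m) (D m)) (P m))) atTop) := by
  obtain ⟨hz0, hGz⟩ := z_pos α z hα1 hz
  have hk : (0:ℝ) < k := by exact_mod_cast (by omega : 0 < k)
  set v : ℕ → ℝ := fun m => variance (hatDelta m k ℓ (Y1 m) (Y0 m) (D m)) (P m) with hvd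
  set E : ℕ → ℝ := fun m => ∫ ω', Vtil m ω' ∂P m with hE
  have hE0 : ∀ m, 0 ≤ E m := fun m => integral_nonneg (hVnonneg m)
  have hv0 : ∀ m, 0 ≤ v m := fun m => variance_nonneg _ _
  obtain ⟨c, hcev, hc⟩ : ∃ c, (∀ᶠ m : ℕ in atTop, c ≤ (m:ℝ) * k * v m) ∧ 0 < c := by
    rw [liminf_eq] at hVarPos
    obtain ⟨c, h1, h2⟩ := exists_lt_of_lt_csSup
      (s := {a : ℝ | ∀ᶠ m : ℕ in atTop, a ≤ (m:ℝ) * k * v m})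
      ⟨0, Eventually.of_forall fun m => by have := hv0 m; positivity⟩ hVarPos
    exact ⟨c, h1, h2⟩
  obtain ⟨C, hC⟩ := hVarBdd
  rw [eventually_map] at hC
  have hT := tendsto_prob P (fun m ω => (√(v m))⁻¹ *
        (hatDelta m k ℓ (Y1 m) (Y0 m) (D m) ω - Delta m k (Y1 m) (Y0 m)))
    (fun m => ((meas_hatDelta (P m) m k ℓ (Y1 m) (Y0 m) (D m) (hD m)).sub_const _).const_mul _)
    (tendsto_charFun_design k ℓ hℓ hℓk Ω P Y1 Y0 D hD hY c hc hcev)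
  have hbad : ∀ ε : ℝ, 0 < ε → ∀ η : ℝ, 0 < η → ∀ᶠ m : ℕ in atTop,
      (P m {ω | ε ≤ (m : ℝ) * k * |Vtil m ω - E m|}).toReal < η := by
    intro ε hε η hη
    have := (ENNReal.tendsto_toReal ENNReal.zero_ne_top).comp (hVcons ε hε)
    exact this.eventually_lt_const (by simpa using hη)
  have hev : ∀ m ω, (hatDelta m k ℓ (Y1 m) (Y0 m) (D m) ω - √(Vtil m ω) * z
                    ≤ Delta m k (Y1 m) (Y0 m) ∧
                  Delta m k (Y1 m) (Y0 m)
                    ≤ hatDelta m k ℓ (Y1 m) (Y0 m) (D m) ω + √(Vtil m ω) * z) ↔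
      |hatDelta m k ℓ (Y1 m) (Y0 m) (D m) ω - Delta m k (Y1 m) (Y0 m)| ≤ √(Vtil m ω) * z := by
    intro m ω
    rw [abs_le]
    constructor
    · rintro ⟨h1, h2⟩; constructor <;> linarith
    · rintro ⟨h1, h2⟩; constructor <;> linarith
  simp_rw [hev]
  rw [le_liminf_iff' _ _ (fun m => ENNReal.toReal_nonneg) (fun m => by
      refine ENNReal.toReal_le_of_le_ofReal zero_le_one ?_
      simpa using prob_le_one),
    liminf_nonneg_iff _ (-C) (by
      filter_upwards [hC] with m hm
      have := hE0 m
      have : 0 ≤ (m:ℝ) * k * E m := by positivity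
      rw [mul_sub]; linarith)]
  constructor
  · intro h ε hε
    by_contra hcon
    rw [not_eventually] at hcon
    set C' := max C ε with hC'
    have hC'0 : 0 < C' := hε.trans_le (le_max_right _ _)
    set ρ := 1 - ε / (2 * C') with hρ
    have hq : ε / (2 * C') ≤ 1 / 2 := by
      rw [div_le_div_iff₀ (by positivity) (by norm_num)]
      have := le_max_right C ε
      linarith
    have hq0 : 0 < ε / (2 * C') := by positivity
    have hρ0 : 0 ≤ ρ := by linarith
    have hρ1 : √ρ < 1 := by rw [Real.sqrt_lt' one_pos]; linarith
    set x := √ρ * z with hx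
    have hx0 : 0 ≤ x := by positivity
    have hxz : x < z := by nlinarith
    have hG := G_strict x z hx0 hxz
    set η := (G z - G x) / 3 with hη
    have hη0 : 0 < η := by linarith
    have e1 := (hT x).eventually_lt_const (show G x < G x + η by linarith)
    obtain ⟨m, hm, e1, e2, e3, e4, e5⟩ := (hcon.and_eventually (e1.and
      ((hbad (ε/2) (by linarith) η hη0).and ((h (η/2) (by linarith)).and (hC.and hcev))))).exists
    have hn : 0 < (m:ℝ) * k := by
      rcases (by positivity : 0 ≤ (m:ℝ) * k).eq_or_lt with h0 | h0
      · rw [← h0] at e5; linarith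
      · exact h0
    have hvm : 0 < v m := pos_of_mul_pos_right (hc.trans_le e5) hn.le
    have := diff_bound (P m) {ω | |hatDelta m k ℓ (Y1 m) (Y0 m) (D m) ω - Delta m k (Y1 m) (Y0 m)| ≤ √(Vtil m ω) * z}
      {ω | ε/2 ≤ (m : ℝ) * k * |Vtil m ω - E m|}
      {ω | |(√(v m))⁻¹ * (hatDelta m k ℓ (Y1 m) (Y0 m) (D m) ω - Delta m k (Y1 m) (Y0 m))| ≤ x} (by
        intro ω hA hB
        rw [Set.mem_ofPred_eq] at hA hB ⊢
        rw [T_le_iff _ _ _ hvm]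
        refine hA.trans ?_
        push Not at hB hm
        have hV : Vtil m ω ≤ ρ * v m := by
          refine le_of_mul_le_mul_left ?_ hn
          have a1 := mul_le_mul_of_nonneg_left (le_abs_self (Vtil m ω - E m)) hn.le
          have a2 : (m:ℝ) * k * v m ≤ C' := e4.trans (le_max_left _ _)
          have a3 : ε / (2 * C') * ((m:ℝ) * k * v m) ≤ ε / 2 := by
            calc _ ≤ ε / (2 * C') * C' := by gcongr
              _ = ε / 2 := by field_simp
          have a4 : (m:ℝ) * k * (ρ * v m) = (m:ℝ) * k * v m - ε / (2 * C') * ((m:ℝ) * k * v m) := by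
            rw [hρ]; ring
          rw [a4]
          rw [mul_sub] at a1 hm
          linarith
        calc √(Vtil m ω) * z ≤ √(ρ * v m) * z := by gcongr
          _ = √(v m) * x := by rw [Real.sqrt_mul hρ0, hx]; ring)
    have hsum : G z - η / 2 ≤ G x + 2 * η := by
      rw [hGz]
      linarith
    linarith
  · intro h η hη
    obtain ⟨x, hx0, hxz, hGx⟩ := G_approx z hz0 (η/2) (by linarith)
    set ρ := (x / z)^2 with hρ
    have hr1 : x / z < 1 := (div_lt_one hz0).2 hxz
    have hr0 : 0 ≤ x / z := by positivity
    have hρ1 : ρ < 1 := by rw [hρ]; nlinarith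
    have hρ0 : 0 ≤ ρ := sq_nonneg _
    set ε := c * (1 - ρ) / 2 with hε
    have hε0 : 0 < ε := by
      have : 0 < 1 - ρ := by linarith
      positivity
    have e1 := (hT x).eventually_const_lt (show G x - η/4 < G x by linarith)
    filter_upwards [e1, hbad ε hε0 (η/4) (by linarith), h ε hε0, hcev] with m e1 e2 e3 e5
    have hn : 0 < (m:ℝ) * k := by
      rcases (by positivity : 0 ≤ (m:ℝ) * k).eq_or_lt with h0 | h0
      · rw [← h0] at e5; linarith
      · exact h0
    have hvm : 0 < v m := pos_of_mul_pos_right (hc.trans_le e5) hn.le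
    have := diff_bound (P m) {ω | |(√(v m))⁻¹ * (hatDelta m k ℓ (Y1 m) (Y0 m) (D m) ω - Delta m k (Y1 m) (Y0 m))| ≤ x}
      {ω | ε ≤ (m : ℝ) * k * |Vtil m ω - E m|}
      {ω | |hatDelta m k ℓ (Y1 m) (Y0 m) (D m) ω - Delta m k (Y1 m) (Y0 m)| ≤ √(Vtil m ω) * z} (by
        intro ω hA hB
        rw [Set.mem_ofPred_eq] at hA hB ⊢
        rw [T_le_iff _ _ _ hvm] at hA
        refine hA.trans ?_
        push Not at hB
        have hV : ρ * v m ≤ Vtil m ω := by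
          refine le_of_mul_le_mul_left ?_ hn
          have a1 := mul_le_mul_of_nonneg_left (neg_abs_le (Vtil m ω - E m)) hn.le
          have a3 : c * (1 - ρ) ≤ ((m:ℝ) * k * v m) * (1 - ρ) :=
            mul_le_mul_of_nonneg_right e5 (by linarith)
          rw [mul_sub] at a1 e3
          linarith
        calc √(v m) * x = √(ρ * v m) * z := by
              rw [Real.sqrt_mul hρ0, hρ, Real.sqrt_sq hr0]; field_simp
          _ ≤ √(Vtil m ω) * z := by gcongr)
    rw [← hGz]
    linarith

end DesignBased
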